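/- For every ε > 0 there is a constant C = C(ε) such that for every squarefree positive integer q, every unit a of Z/qZ, and all real numbers M, N with 1 ≤ N ≤ q^(3/4) and 1 ≤ M < q/2, the number of pairs (m, n) of positive integers with m ≤ M, n ≤ N, gcd(m,q) = 1 and m·n² ≡ a (mod q) is at most C · M^(1/4) · N^(2/3) · q^ε. -/

import Mathlib

open Finset

/-- A finset of residues modulo a squarefree `q` is no larger than the product of the sizes of
its reductions modulo the primes dividing `q`. -/
lemma card_le_prod_primeFactors {q : ℕ} (hq : Squarefree q) (Z : Finset (ZMod q)) (c : ℕ → ℕ)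
    (h : ∀ p (hp : p ∈ q.primeFactors),
      #(Z.image (ZMod.castHom (Nat.dvd_of_mem_primeFactors hp) (ZMod p))) ≤ c p) :
    #Z ≤ ∏ p ∈ q.primeFactors, c p := by
  classical
  have : NeZero q := ⟨hq.ne_zero⟩
  let f : ZMod q → ∀ p ∈ q.primeFactors, ZMod p :=
    fun x p hp => ZMod.castHom (Nat.dvd_of_mem_primeFactors hp) (ZMod p) x
  have hinj : Function.Injective f := by
    intro x y hxy
    have hdvd : (q : ℤ) ∣ (x.val : ℤ) - y.val := by
      suffices h : ((∏ p ∈ q.primeFactors, p : ℕ) : ℤ) ∣ (x.val : ℤ) - y.val by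
        rwa [Nat.prod_primeFactors_of_squarefree hq] at h
      push_cast
      refine Finset.prod_dvd_of_coprime (fun p hp r hr hpr => ?_) (fun p hp => ?_)
      · exact Nat.isCoprime_iff_coprime.2 ((Nat.coprime_primes
          (Nat.prime_of_mem_primeFactors hp) (Nat.prime_of_mem_primeFactors hr)).2 hpr)
      · have := congrFun (congrFun hxy p) hp
        simp only [f] at this
        rw [← ZMod.natCast_zmod_val x, ← ZMod.natCast_zmod_val y, map_natCast, map_natCast] at this
        rw [← ZMod.intCast_zmod_eq_zero_iff_dvd]
        push_cast
        rw [this, sub_self]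
    have := (ZMod.intCast_zmod_eq_zero_iff_dvd _ q).2 hdvd
    push_cast at this
    simpa [sub_eq_zero] using this
  calc #Z = #(Z.image f) := (card_image_of_injective _ hinj).symm
    _ ≤ #(q.primeFactors.pi fun p => if hp : p ∈ q.primeFactors then
        Z.image (ZMod.castHom (Nat.dvd_of_mem_primeFactors hp) (ZMod p)) else ∅) := by
      refine card_le_card fun g hg => ?_
      obtain ⟨x, hx, rfl⟩ := mem_image.1 hg
      refine mem_pi.2 fun p hp => ?_
      rw [dif_pos hp]
      exact mem_image_of_mem _ hx
    _ ≤ ∏ p ∈ q.primeFactors, c p := by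
      rw [card_pi]
      refine prod_le_prod' fun p hp => ?_
      rw [dif_pos hp]
      exact h p hp

lemma card_divisors_of_squarefree {q : ℕ} (hq : Squarefree q) :
    #q.divisors = 2 ^ #q.primeFactors := by
  rw [Nat.card_divisors hq.ne_zero, ← prod_const]
  refine prod_congr rfl fun p hp => ?_
  rw [Nat.factorization_eq_one_of_squarefree hq (Nat.prime_of_mem_primeFactors hp)
    (Nat.dvd_of_mem_primeFactors hp)]

lemma card_sq_eq_le_two {F : Type*} [Field F] (Z : Finset F) (c : F) (h : ∀ x ∈ Z, x ^ 2 = c) :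
    #Z ≤ 2 := by
  have hne : (Polynomial.X ^ 2 - Polynomial.C c) ≠ 0 :=
    Polynomial.X_pow_sub_C_ne_zero two_pos c
  calc #Z ≤ (Polynomial.X ^ 2 - Polynomial.C c).natDegree :=
      Polynomial.card_le_degree_of_subset_roots fun x hx => by
        rw [Polynomial.mem_roots hne]
        simp [h x (by simpa using hx)]
    _ = 2 := Polynomial.natDegree_X_pow_sub_C

lemma card_sq_eq_le_card_divisors {q : ℕ} (hq : Squarefree q) (Z : Finset (ZMod q)) (c : ZMod q)
    (h : ∀ x ∈ Z, x ^ 2 = c) : #Z ≤ #q.divisors := by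
  rw [card_divisors_of_squarefree hq, ← prod_const]
  refine card_le_prod_primeFactors hq Z _ fun p hp => ?_
  have : Fact p.Prime := ⟨Nat.prime_of_mem_primeFactors hp⟩
  refine card_sq_eq_le_two _ (ZMod.castHom (Nat.dvd_of_mem_primeFactors hp) (ZMod p) c) ?_
  intro y hy
  obtain ⟨x, hx, rfl⟩ := mem_image.1 hy
  rw [← map_pow, h x hx]

/-- For units, `x₁⁻² + x₂⁻² = x₃⁻² + x₄⁻²`, with denominators cleared. -/
def InvSqRel {R : Type*} [CommRing R] (x₁ x₂ x₃ x₄ : R) : Prop :=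
  IsUnit x₁ ∧ IsUnit x₂ ∧ IsUnit x₃ ∧ IsUnit x₄ ∧
    x₂ ^ 2 * x₃ ^ 2 * x₄ ^ 2 + x₁ ^ 2 * x₃ ^ 2 * x₄ ^ 2 =
      x₁ ^ 2 * x₂ ^ 2 * x₄ ^ 2 + x₁ ^ 2 * x₂ ^ 2 * x₃ ^ 2

lemma InvSqRel.map {R S : Type*} [CommRing R] [CommRing S] (f : R →+* S) {x₁ x₂ x₃ x₄ : R}
    (h : InvSqRel x₁ x₂ x₃ x₄) : InvSqRel (f x₁) (f x₂) (f x₃) (f x₄) := by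
  obtain ⟨h1, h2, h3, h4, h⟩ := h
  refine ⟨h1.map f, h2.map f, h3.map f, h4.map f, ?_⟩
  simpa using congrArg f h

open Polynomial in
lemma card_invSqRel_le_six {F : Type*} [Field F] (h2 : (2 : F) ≠ 0) (v₁ v₂ v₃ v₄ : F)
    (h13 : v₁ ≠ v₃) (h14 : v₁ ≠ v₄) (Z : Finset F)
    (h : ∀ s ∈ Z, InvSqRel (s - v₁) (s - v₂) (s - v₃) (s - v₄)) : #Z ≤ 6 := by
  have key : ∀ P : F[X], P ≠ 0 → P.natDegree ≤ 6 → (∀ s ∈ Z, P.eval s = 0) → #Z ≤ 6 := by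
    intro P hP hd hroot
    refine (Polynomial.card_le_degree_of_subset_roots fun x hx => ?_).trans hd
    rw [Polynomial.mem_roots hP]
    exact hroot x (by simpa using hx)
  have h13' := sub_ne_zero.2 h13
  have h14' := sub_ne_zero.2 h14
  by_cases h12 : v₁ = v₂
  · subst h12
    refine key (2 * (X - C v₃) ^ 2 * (X - C v₄) ^ 2
      - (X - C v₁) ^ 2 * (X - C v₄) ^ 2 - (X - C v₁) ^ 2 * (X - C v₃) ^ 2) ?_ ?_ ?_
    · intro h0
      have := congrArg (eval v₁) h0
      simp [h2, h13', h14'] at this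
    · compute_degree
      norm_num
    · intro s hs
      obtain ⟨h1, -, -, -, h⟩ := h s hs
      refine (mul_eq_zero_iff_left (pow_ne_zero 2 h1.ne_zero)).1 ?_
      simp only [eval_sub, eval_mul, eval_pow, eval_X, eval_C, eval_ofNat]
      linear_combination h
  · have h12' := sub_ne_zero.2 h12
    refine key ((X - C v₂) ^ 2 * (X - C v₃) ^ 2 * (X - C v₄) ^ 2
      + (X - C v₁) ^ 2 * (X - C v₃) ^ 2 * (X - C v₄) ^ 2
      - (X - C v₁) ^ 2 * (X - C v₂) ^ 2 * (X - C v₄) ^ 2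
      - (X - C v₁) ^ 2 * (X - C v₂) ^ 2 * (X - C v₃) ^ 2) ?_ ?_ ?_
    · intro h0
      have := congrArg (eval v₁) h0
      simp [h12', h13', h14'] at this
    · compute_degree
    · intro s hs
      obtain ⟨-, -, -, -, h⟩ := h s hs
      simp only [eval_sub, eval_add, eval_mul, eval_pow, eval_X, eval_C]
      linear_combination h

lemma prod_primeFactors_gcd_le {q : ℕ} (hq : q ≠ 0) (k : ℕ) :
    ∏ p ∈ q.primeFactors, p.gcd k ≤ q.gcd k := by
  refine Nat.le_of_dvd (Nat.gcd_pos_of_pos_left _ (Nat.pos_of_ne_zero hq)) ?_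
  refine Finset.prod_dvd_of_isRelPrime (fun p hp r hr hpr => ?_) fun p hp =>
    Nat.gcd_dvd_gcd_of_dvd_left _ (Nat.dvd_of_mem_primeFactors hp)
  exact Nat.coprime_iff_isRelPrime.1 (((Nat.coprime_primes (Nat.prime_of_mem_primeFactors hp)
    (Nat.prime_of_mem_primeFactors hr)).2 hpr).of_dvd (Nat.gcd_dvd_left _ _)
    (Nat.gcd_dvd_left _ _))

lemma card_invSqRel_le {q : ℕ} (hq : Squarefree q) (v₁ v₂ v₃ v₄ : ℤ) (Z : Finset (ZMod q))
    (h : ∀ s ∈ Z, InvSqRel (s - v₁) (s - v₂) (s - v₃) (s - v₄)) :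
    #Z ≤ #q.divisors ^ 3 * (q.gcd (v₁ - v₃).natAbs * q.gcd (v₁ - v₄).natAbs) := by
  calc #Z ≤ ∏ p ∈ q.primeFactors, (2 ^ 3 * (p.gcd (v₁ - v₃).natAbs * p.gcd (v₁ - v₄).natAbs)) := by
        refine card_le_prod_primeFactors hq Z _ fun p hp => ?_
        have hpp := Nat.prime_of_mem_primeFactors hp
        have : Fact p.Prime := ⟨hpp⟩
        set φ := ZMod.castHom (Nat.dvd_of_mem_primeFactors hp) (ZMod p)
        have hpos : ∀ k, 1 ≤ p.gcd k := fun k => Nat.gcd_pos_of_pos_left _ hpp.pos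
        have htriv : #(Z.image φ) ≤ p := by
          simpa [ZMod.card] using card_le_univ (Z.image φ)
        have hgcd : ∀ v w : ℤ, (v : ZMod p) = w → p.gcd (v - w).natAbs = p := by
          intro v w hvw
          refine Nat.gcd_eq_left ?_
          rw [← Int.natCast_dvd, ← ZMod.intCast_zmod_eq_zero_iff_dvd]
          simp [hvw]
        by_cases h13 : (v₁ : ZMod p) = v₃
        · rw [hgcd _ _ h13]
          nlinarith [hpos (v₁ - v₄).natAbs]
        by_cases h14 : (v₁ : ZMod p) = v₄
        · rw [hgcd _ _ h14]
          nlinarith [hpos (v₁ - v₃).natAbs]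
        refine le_trans ?_ (Nat.le_mul_of_pos_right _ (Nat.mul_pos (hpos _) (hpos _)))
        rcases hpp.eq_two_or_odd with rfl | hodd
        · omega
        refine (card_invSqRel_le_six ?_ (v₁ : ZMod p) v₂ v₃ v₄ h13 h14 _ ?_).trans (by norm_num)
        · intro h2
          have : p ∣ 2 := (ZMod.natCast_eq_zero_iff 2 p).1 (by exact_mod_cast h2)
          have := Nat.le_of_dvd two_pos this
          have := hpp.two_le
          omega
        · intro y hy
          obtain ⟨s, hs, rfl⟩ := mem_image.1 hy
          simpa using (h s hs).map φ
    _ ≤ _ := by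
        rw [prod_mul_distrib, prod_mul_distrib, prod_const, card_divisors_of_squarefree hq,
          ← pow_mul, ← pow_mul, mul_comm 3]
        gcongr <;> exact prod_primeFactors_gcd_le hq.ne_zero _

lemma sum_gcd_le (q V : ℕ) (hq : q ≠ 0) : ∑ k ∈ Icc 1 V, q.gcd k ≤ #q.divisors * V := by
  calc ∑ k ∈ Icc 1 V, q.gcd k ≤ ∑ k ∈ Icc 1 V, ∑ d ∈ q.divisors, if d ∣ k then d else 0 := by
        refine sum_le_sum fun k _ => ?_
        refine le_trans (le_of_eq ?_) (single_le_sum (f := fun d => if d ∣ k then d else 0)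
          (fun _ _ => Nat.zero_le _) (Nat.mem_divisors.2 ⟨Nat.gcd_dvd_left q k, hq⟩))
        simp [Nat.gcd_dvd_right]
    _ = ∑ d ∈ q.divisors, #{k ∈ Ioc 0 V | d ∣ k} * d := by
        rw [sum_comm]
        refine sum_congr rfl fun d _ => ?_
        rw [← sum_filter, sum_const, smul_eq_mul]
        rfl
    _ ≤ ∑ d ∈ q.divisors, V := by
        refine sum_le_sum fun d _ => ?_
        rw [Nat.Ioc_filter_dvd_card_eq_div]
        exact Nat.div_mul_le_self V d
    _ = _ := by simp

lemma sum_gcd_sub_le {q V v : ℕ} (hq : q ≠ 0) (hv : v ∈ Icc 1 V) :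
    ∑ w ∈ Icc 1 V with v ≠ w, q.gcd ((v : ℤ) - w).natAbs ≤ 2 * (#q.divisors * V) := by
  rw [mem_Icc] at hv
  have key : ∀ W ⊆ Icc 1 V, Set.InjOn (fun w : ℕ => ((v : ℤ) - w).natAbs) W → v ∉ W →
      ∑ w ∈ W, q.gcd ((v : ℤ) - w).natAbs ≤ #q.divisors * V := by
    intro W hW hinj hvW
    refine le_trans ?_ (sum_gcd_le q V hq)
    rw [← sum_image (f := q.gcd) hinj]
    refine sum_le_sum_of_subset fun k hk => ?_
    obtain ⟨w, hw, rfl⟩ := mem_image.1 hk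
    have := mem_Icc.1 (hW hw)
    have : w ≠ v := fun h => hvW (h ▸ hw)
    simp only [mem_Icc]
    omega
  rw [← sum_filter_add_sum_filter_not _ (fun w => w < v), two_mul]
  refine add_le_add (key _ (fun w hw => ?_) (fun w hw w' hw' h => ?_) (by simp))
    (key _ (fun w hw => ?_) (fun w hw w' hw' h => ?_) (by simp))
  · simp only [mem_filter] at hw
    exact hw.1.1
  · simp only [coe_filter, mem_filter, Set.mem_ofPred_eq] at hw hw' h
    omega
  · simp only [mem_filter] at hw
    exact hw.1.1
  · simp only [coe_filter, mem_filter, Set.mem_ofPred_eq] at hw hw' h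
    omega

open Classical in
/-- The number of quadruples of shifts of `s` by at most `V` satisfying `InvSqRel`, the first shift
being different from the last two. -/
noncomputable def relCount (q V : ℕ) (s : ZMod q) : ℕ :=
  #{x ∈ (Icc 1 V ×ˢ Icc 1 V) ×ˢ (Icc 1 V ×ˢ Icc 1 V) | x.1.1 ≠ x.2.1 ∧ x.1.1 ≠ x.2.2 ∧
    InvSqRel (s - (x.1.1 : ZMod q)) (s - (x.1.2 : ZMod q)) (s - (x.2.1 : ZMod q))
      (s - (x.2.2 : ZMod q))}

lemma sum_relCount_le {q : ℕ} [NeZero q] (hq : Squarefree q) (V : ℕ) :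
    ∑ s : ZMod q, relCount q V s ≤ 4 * V ^ 4 * #q.divisors ^ 5 := by
  classical
  set T := #q.divisors
  set g : ℕ → ℕ → ℕ := fun v w => q.gcd ((v : ℤ) - w).natAbs
  calc ∑ s : ZMod q, relCount q V s
      = ∑ x ∈ (Icc 1 V ×ˢ Icc 1 V) ×ˢ (Icc 1 V ×ˢ Icc 1 V),
        #{s : ZMod q | x.1.1 ≠ x.2.1 ∧ x.1.1 ≠ x.2.2 ∧
          InvSqRel (s - (x.1.1 : ZMod q)) (s - (x.1.2 : ZMod q)) (s - (x.2.1 : ZMod q))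
            (s - (x.2.2 : ZMod q))} := by
        simp only [relCount, card_filter]
        exact sum_comm
    _ ≤ ∑ x ∈ (Icc 1 V ×ˢ Icc 1 V) ×ˢ (Icc 1 V ×ˢ Icc 1 V),
        T ^ 3 * ((if x.1.1 ≠ x.2.1 then g x.1.1 x.2.1 else 0) *
          (if x.1.1 ≠ x.2.2 then g x.1.1 x.2.2 else 0)) := by
        refine sum_le_sum fun x _ => ?_
        by_cases h1 : x.1.1 = x.2.1
        · simp [h1]
        by_cases h2 : x.1.1 = x.2.2
        · simp [h2]
        rw [if_pos h1, if_pos h2]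
        refine card_invSqRel_le hq x.1.1 x.1.2 x.2.1 x.2.2 _ fun s hs => ?_
        simpa using (mem_filter.1 hs).2.2.2
    _ = ∑ v ∈ Icc 1 V, ∑ v₂ ∈ Icc 1 V, T ^ 3 * ((∑ w ∈ Icc 1 V with v ≠ w, g v w) *
          (∑ w ∈ Icc 1 V with v ≠ w, g v w)) := by
        rw [sum_product, sum_product]
        refine sum_congr rfl fun v _ => sum_congr rfl fun v₂ _ => ?_
        rw [← mul_sum, sum_product, sum_filter, sum_mul_sum]
    _ ≤ ∑ v ∈ Icc 1 V, ∑ v₂ ∈ Icc 1 V, T ^ 3 * ((2 * (T * V)) * (2 * (T * V))) := by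
        refine sum_le_sum fun v hv => sum_le_sum fun v₂ _ => ?_
        have := sum_gcd_sub_le hq.ne_zero hv
        gcongr
    _ = _ := by
        simp only [sum_const, Nat.card_Icc, add_tsub_cancel_right, smul_eq_mul]
        ring

lemma sum_card_fiber_sq {α β : Type*} [DecidableEq β] (s : Finset α) (t : Finset β)
    (f : α → β) (h : ∀ x ∈ s, f x ∈ t) :
    ∑ b ∈ t, #{a ∈ s | f a = b} ^ 2 = #{x ∈ s ×ˢ s | f x.1 = f x.2} := by
  rw [card_eq_sum_card_fiberwise (f := fun x => f x.1) (t := t)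
    fun x hx => h _ (mem_product.1 (mem_filter.1 hx).1).1]
  refine sum_congr rfl fun b _ => ?_
  rw [sq, ← card_product]
  congr 1
  ext x
  simp only [mem_product, mem_filter]
  constructor
  · rintro ⟨⟨h1, h2⟩, h3, h4⟩
    exact ⟨⟨⟨h1, h3⟩, h2.trans h4.symm⟩, h2⟩
  · rintro ⟨⟨⟨h1, h3⟩, h2⟩, h4⟩
    exact ⟨⟨h1, h4⟩, h3, h2 ▸ h4⟩

lemma card_sq_le_card_mul_card_eq {α β : Type*} [DecidableEq β] (s : Finset α) (t : Finset β)
    (f : α → β) (h : ∀ x ∈ s, f x ∈ t) :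
    #s ^ 2 ≤ #t * #{x ∈ s ×ˢ s | f x.1 = f x.2} := by
  rw [← sum_card_fiber_sq s t f h, card_eq_sum_card_fiberwise h]
  exact sq_sum_le_card_mul_sum_sq

lemma natCast_inj_of_lt {q m n : ℕ} (hm : m < q) (hn : n < q) (h : (m : ZMod q) = n) : m = n := by
  rw [ZMod.natCast_eq_natCast_iff] at h
  exact Nat.ModEq.eq_of_lt_of_lt h hm hn

/-- Fourth moment bound for shifts `v ≤ V` with `b (s - v)⁻²` reducing to a number in `[1, M]`. -/
lemma card_pow_four_le {q M V : ℕ} (hq : Squarefree q) (hV : V < q) (s : ZMod q)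
    (b : (ZMod q)ˣ) (I : Finset ℕ) (hI : I ⊆ Icc 1 V)
    (h : ∀ v ∈ I, ∃ m ∈ Icc 1 M, (m : ZMod q) * (s - v) ^ 2 = b) :
    #I ^ 4 ≤ 2 * M * (2 * #q.divisors * #I ^ 2 + relCount q V s) := by
  classical
  choose! μ hμ hμb using h
  simp only [mem_Icc] at hμ
  have hu : ∀ v ∈ I, IsUnit (s - (v : ZMod q)) := fun v hv =>
    (isUnit_pow_iff two_ne_zero).1 (isUnit_of_mul_isUnit_right ((hμb v hv) ▸ b.isUnit))
  have hμu : ∀ v ∈ I, IsUnit (μ v : ZMod q) := fun v hv =>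
    isUnit_of_mul_isUnit_left ((hμb v hv) ▸ b.isUnit)
  have hVq : ∀ v ∈ I, v < q := fun v hv => (mem_Icc.1 (hI hv)).2.trans_lt hV
  set E := {x ∈ (I ×ˢ I) ×ˢ (I ×ˢ I) | μ x.1.1 + μ x.1.2 = μ x.2.1 + μ x.2.2} with hE
  have hsq : #I ^ 4 ≤ 2 * M * #E := by
    have := card_sq_le_card_mul_card_eq (I ×ˢ I) (Icc 1 (2 * M)) (fun x => μ x.1 + μ x.2) ?_
    · rw [card_product, Nat.card_Icc, add_tsub_cancel_right] at this
      calc #I ^ 4 = (#I * #I) ^ 2 := by ring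
        _ ≤ _ := this
    · intro x hx
      rw [mem_product] at hx
      have := hμ _ hx.1
      have := hμ _ hx.2
      rw [mem_Icc]
      omega
  have hsame : ∀ x₁ ∈ I, #{y ∈ I | μ y = μ x₁} ≤ #q.divisors := by
    intro x₁ hx₁
    rw [← card_image_of_injOn (f := fun y : ℕ => s - (y : ZMod q))]
    · refine card_sq_eq_le_card_divisors hq _ ((s - x₁) ^ 2) fun z hz => ?_
      obtain ⟨y, hy, rfl⟩ := mem_image.1 hz
      rw [mem_filter] at hy
      have h1 := hμb y hy.1
      rw [← hμb x₁ hx₁, hy.2] at h1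
      exact (hμu x₁ hx₁).mul_left_cancel h1
    · intro y hy z hz hyz
      simp only [coe_filter, Set.mem_ofPred_eq] at hy hz
      exact natCast_inj_of_lt (hVq y hy.1) (hVq z hz.1) (sub_right_injective hyz)
  have hdiag : ∀ A ⊆ E, (∃ i : (ℕ × ℕ) × (ℕ × ℕ) → ℕ, (∀ x ∈ A, i x ∈ I ∧ μ (i x) = μ x.1.2) ∧
      Set.InjOn (fun x => (x.1, i x)) A) → #A ≤ #q.divisors * #I ^ 2 := by
    rintro A hA ⟨i, hi, hinj⟩
    rw [← card_image_of_injOn hinj, sq, ← card_product]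
    rw [mul_comm]
    refine card_le_mul_card_image_of_maps_to (f := Prod.fst) ?_ _ ?_ |>.trans_eq (mul_comm _ _)
    · intro z hz
      obtain ⟨x, hx, rfl⟩ := mem_image.1 hz
      exact (mem_product.1 (mem_filter.1 (hA hx)).1).1
    · intro w hw
      rw [mem_product] at hw
      refine le_trans ?_ (hsame w.2 hw.2)
      refine card_le_card_of_injOn Prod.snd ?_ ?_
      · intro z hz
        simp only [coe_filter, Set.mem_ofPred_eq, mem_image] at hz ⊢
        obtain ⟨⟨x, hx, rfl⟩, rfl⟩ := hz
        exact ⟨(hi x hx).1, (hi x hx).2⟩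
      · intro z hz z' hz' hzz
        simp only [coe_filter, Set.mem_ofPred_eq] at hz hz'
        exact Prod.ext (hz.2.trans hz'.2.symm) hzz
  have hEle : #E ≤ 2 * #q.divisors * #I ^ 2 + relCount q V s := by
    have hsub : E ⊆ ({x ∈ E | x.1.1 = x.2.1} ∪ {x ∈ E | x.1.1 = x.2.2}) ∪
        {x ∈ E | x.1.1 ≠ x.2.1 ∧ x.1.1 ≠ x.2.2} := by
      intro x hx
      simp only [mem_union, mem_filter]
      tauto
    have h1 : #{x ∈ E | x.1.1 = x.2.1} ≤ #q.divisors * #I ^ 2 := by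
      refine hdiag _ (filter_subset _ _) ⟨fun x => x.2.2, ?_, ?_⟩
      · intro x hx
        simp only [hE, mem_filter, mem_product] at hx
        refine ⟨hx.1.1.2.2, ?_⟩
        have := hx.1.2
        rw [hx.2] at this
        exact (add_left_cancel this).symm
      · rintro ⟨⟨x1, x2⟩, x3, x4⟩ hx ⟨⟨y1, y2⟩, y3, y4⟩ hy hxy
        simp only [coe_filter, Set.mem_ofPred_eq] at hx hy
        simp only [Prod.mk.injEq] at hxy ⊢
        omega
    have h2 : #{x ∈ E | x.1.1 = x.2.2} ≤ #q.divisors * #I ^ 2 := by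
      refine hdiag _ (filter_subset _ _) ⟨fun x => x.2.1, ?_, ?_⟩
      · intro x hx
        simp only [hE, mem_filter, mem_product] at hx
        refine ⟨hx.1.1.2.1, ?_⟩
        have := hx.1.2
        rw [hx.2] at this
        exact (add_left_cancel (this.trans (add_comm _ _))).symm
      · rintro ⟨⟨x1, x2⟩, x3, x4⟩ hx ⟨⟨y1, y2⟩, y3, y4⟩ hy hxy
        simp only [coe_filter, Set.mem_ofPred_eq] at hx hy
        simp only [Prod.mk.injEq] at hxy ⊢
        omega
    have h3 : #{x ∈ E | x.1.1 ≠ x.2.1 ∧ x.1.1 ≠ x.2.2} ≤ relCount q V s := by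
      refine card_le_card fun x hx => ?_
      simp only [hE, mem_filter, mem_product] at hx ⊢
      obtain ⟨⟨⟨⟨i1, i2⟩, i3, i4⟩, he⟩, hne⟩ := hx
      refine ⟨⟨⟨hI i1, hI i2⟩, hI i3, hI i4⟩, hne.1, hne.2, hu _ i1, hu _ i2, hu _ i3, hu _ i4, ?_⟩
      have he' : (μ x.1.1 : ZMod q) + μ x.1.2 = μ x.2.1 + μ x.2.2 := by
        rw [← Nat.cast_add, he, Nat.cast_add]
      refine b.isUnit.mul_left_cancel ?_
      have e1 := hμb _ i1
      have e2 := hμb _ i2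
      have e3 := hμb _ i3
      have e4 := hμb _ i4
      generalize s - (x.1.1 : ZMod q) = y1 at *
      generalize s - (x.1.2 : ZMod q) = y2 at *
      generalize s - (x.2.1 : ZMod q) = y3 at *
      generalize s - (x.2.2 : ZMod q) = y4 at *
      linear_combination (y1 * y2 * y3 * y4) ^ 2 * he' - y2 ^ 2 * y3 ^ 2 * y4 ^ 2 * e1
        - y1 ^ 2 * y3 ^ 2 * y4 ^ 2 * e2 + y1 ^ 2 * y2 ^ 2 * y4 ^ 2 * e3
        + y1 ^ 2 * y2 ^ 2 * y3 ^ 2 * e4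
    have := (card_le_card hsub).trans ((card_union_le _ _).trans
      (Nat.add_le_add_right (card_union_le _ _) _))
    nlinarith
  exact hsq.trans (Nat.mul_le_mul_left _ hEle)

lemma sum_sqrt_comp_le {α β : Type*} [DecidableEq β] [Fintype β] (s : Finset α) (f : α → β)
    (r : β → ℕ) :
    ∑ x ∈ s, √(r (f x) : ℝ) ≤ √((#{x ∈ s ×ˢ s | f x.1 = f x.2} : ℝ) * (∑ b, r b : ℕ)) := by
  refine Real.le_sqrt_of_sq_le ?_
  calc (∑ x ∈ s, √(r (f x) : ℝ)) ^ 2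
      = (∑ b, (#{x ∈ s | f x = b} : ℝ) * √(r b : ℝ)) ^ 2 := by
        rw [← sum_fiberwise_of_maps_to (g := f) (t := univ) fun _ _ => mem_univ _]
        congr 1
        refine sum_congr rfl fun b _ => ?_
        rw [sum_congr rfl fun x hx => by rw [(mem_filter.1 hx).2], sum_const, nsmul_eq_mul]
    _ ≤ (∑ b, (#{x ∈ s | f x = b} : ℝ) ^ 2) * ∑ b, √(r b : ℝ) ^ 2 := sum_mul_sq_le_sq_mul_sq _ _ _
    _ = _ := by
        rw [← sum_card_fiber_sq s univ f fun _ _ => mem_univ _]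
        push_cast
        congr 1
        exact sum_congr rfl fun b _ => Real.sq_sqrt (Nat.cast_nonneg _)

lemma card_ratio_eq_le {q N U D : ℕ} (hNU : N * U ≤ q)
    (hD : ∀ k, 0 < k → k ≤ q → #k.divisors ≤ D) :
    #{x ∈ (Icc 1 N ×ˢ {u ∈ Icc 1 U | u.Coprime q}) ×ˢ (Icc 1 N ×ˢ {u ∈ Icc 1 U | u.Coprime q}) |
      (x.1.1 : ZMod q) * (x.1.2 : ZMod q)⁻¹ = (x.2.1 : ZMod q) * (x.2.2 : ZMod q)⁻¹} ≤
      D * (N * U) := by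
  set Q := {x ∈ (Icc 1 N ×ˢ {u ∈ Icc 1 U | u.Coprime q}) ×ˢ
    (Icc 1 N ×ˢ {u ∈ Icc 1 U | u.Coprime q}) |
      (x.1.1 : ZMod q) * (x.1.2 : ZMod q)⁻¹ = (x.2.1 : ZMod q) * (x.2.2 : ZMod q)⁻¹} with hQ
  have hcross : ∀ x ∈ Q, x.1.1 * x.2.2 = x.2.1 * x.1.2 := by
    intro x hx
    simp only [hQ, mem_filter, mem_product, mem_Icc] at hx
    obtain ⟨⟨⟨hn, hu, huq⟩, hn', hu', huq'⟩, h⟩ := hx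
    have h1 : 1 ≤ x.1.1 * x.2.2 := Nat.mul_pos hn.1 hu'.1
    have h2 : x.1.1 * x.2.2 ≤ q := (Nat.mul_le_mul hn.2 hu'.2).trans hNU
    have h3 : 1 ≤ x.2.1 * x.1.2 := Nat.mul_pos hn'.1 hu.1
    have h4 : x.2.1 * x.1.2 ≤ q := (Nat.mul_le_mul hn'.2 hu.2).trans hNU
    have e1 := ZMod.coe_mul_inv_eq_one _ huq
    have e2 := ZMod.coe_mul_inv_eq_one _ huq'
    have hmod : ((x.1.1 * x.2.2 : ℕ) : ZMod q) = (x.2.1 * x.1.2 : ℕ) := by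
      push_cast
      linear_combination (x.1.2 : ZMod q) * x.2.2 * h - (x.1.1 : ZMod q) * x.2.2 * e1
        + (x.2.1 : ZMod q) * x.1.2 * e2
    have := ((ZMod.natCast_eq_natCast_iff _ _ _).1 hmod).dvd
    have := Int.eq_zero_of_abs_lt_dvd this (by rw [abs_lt]; omega)
    omega
  have hNcard : N * U = #(Icc 1 N ×ˢ Icc 1 U) := by simp
  rw [hNcard]
  refine card_le_mul_card_image_of_maps_to (f := fun x => (x.1.1, x.2.2)) ?_ _ ?_
  · intro x hx
    simp only [hQ, mem_filter, mem_product] at hx ⊢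
    exact ⟨hx.1.1.1, hx.1.2.2.1⟩
  · rintro ⟨n, u⟩ hnu
    simp only [mem_product, mem_Icc] at hnu
    refine le_trans (card_le_card_of_injOn (t := (n * u).divisors) (fun x => x.1.2) ?_ ?_)
      (hD _ (Nat.mul_pos hnu.1.1 hnu.2.1) ((Nat.mul_le_mul hnu.1.2 hnu.2.2).trans hNU))
    · intro x hx
      simp only [coe_filter, Set.mem_ofPred_eq, Prod.mk.injEq] at hx
      have := hcross x hx.1
      rw [hx.2.1, hx.2.2] at this
      simp only [mem_coe, Nat.mem_divisors]
      exact ⟨this ▸ dvd_mul_left _ _, (Nat.mul_pos hnu.1.1 hnu.2.1).ne'⟩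
    · intro x hx y hy hxy
      simp only [coe_filter, Set.mem_ofPred_eq, Prod.mk.injEq] at hx hy hxy
      have h1 := hcross x hx.1
      have h2 := hcross y hy.1
      have hpos : 0 < x.1.2 := by
        have := hx.1
        simp only [hQ, mem_filter, mem_product, mem_Icc] at this
        exact this.1.1.2.1.1
      rw [hx.2.1, hx.2.2] at h1
      rw [hy.2.1, hy.2.2, ← hxy, h1] at h2
      have h3 := Nat.eq_of_mul_eq_mul_right hpos h2
      exact Prod.ext (Prod.ext (hx.2.1.trans hy.2.1.symm) hxy)
        (Prod.ext h3 (hx.2.2.trans hy.2.2.symm))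

open ArithmeticFunction in
lemma sum_moebius_divisors_gcd {q u : ℕ} (hq : q ≠ 0) :
    ∑ d ∈ q.divisors, (if d ∣ u then moebius d else 0) = if u.Coprime q then 1 else 0 := by
  rw [← sum_filter]
  have : {d ∈ q.divisors | d ∣ u} = (u.gcd q).divisors := by
    ext d
    simp only [mem_filter, Nat.mem_divisors, Nat.dvd_gcd_iff]
    have : u.gcd q ≠ 0 := Nat.gcd_ne_zero_right hq
    tauto
  rw [this, ← coe_mul_zeta_apply, moebius_mul_coe_zeta, one_apply]

open ArithmeticFunction in
lemma card_coprime_eq_sum {q : ℕ} (hq : q ≠ 0) (U : ℕ) :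
    (#{u ∈ Icc 1 U | u.Coprime q} : ℤ) = ∑ d ∈ q.divisors, moebius d * (U / d : ℕ) := by
  rw [card_filter]
  push_cast
  rw [sum_congr rfl fun u _ => (sum_moebius_divisors_gcd hq).symm, sum_comm]
  refine sum_congr rfl fun d _ => ?_
  rw [← sum_filter, sum_const, nsmul_eq_mul, mul_comm]
  congr 2
  exact Nat.Ioc_filter_dvd_card_eq_div U d

lemma le_card_divisors_mul_totient {q : ℕ} (hq : q ≠ 0) : q ≤ #q.divisors * q.totient := by
  calc q = ∑ d ∈ q.divisors, d.totient := (Nat.sum_totient q).symm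
    _ ≤ ∑ d ∈ q.divisors, q.totient := sum_le_sum fun d hd =>
        Nat.le_of_dvd (Nat.totient_pos.2 (Nat.pos_of_ne_zero hq))
          (Nat.totient_dvd_of_dvd (Nat.dvd_of_mem_divisors hd))
    _ = _ := by simp

open ArithmeticFunction in
/-- A lower bound for the number of integers in `[1, U]` that are prime to `q`. -/
lemma le_card_coprime {q : ℕ} (hq : q ≠ 0) (U : ℕ) :
    U ≤ #q.divisors * #{u ∈ Icc 1 U | u.Coprime q} + #q.divisors ^ 2 := by
  set T := #q.divisors
  set W := #{u ∈ Icc 1 U | u.Coprime q} with hW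
  have htot : (q.totient : ℤ) = ∑ d ∈ q.divisors, moebius d * (q / d : ℕ) := by
    rw [← card_coprime_eq_sum hq q]
    congr 1
    rw [← Nat.filter_coprime_Ico_eq_totient q 1, add_comm 1 q]
    congr 1
    ext u
    simp only [mem_filter, mem_Ico, mem_Icc, Nat.coprime_comm (m := q), Nat.lt_succ_iff]
  have hdiff : (U : ℤ) * q.totient - q * W ≤ q * T := by
    rw [htot, card_coprime_eq_sum hq U, mul_sum, mul_sum, ← sum_sub_distrib]
    calc _ ≤ ∑ d ∈ q.divisors, (q : ℤ) := by
          refine sum_le_sum fun d hd => ?_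
          obtain ⟨e, rfl⟩ := Nat.dvd_of_mem_divisors hd
          have hd0 : 0 < d := Nat.pos_of_mem_divisors hd
          rw [Nat.mul_div_cancel_left _ hd0]
          have h1 := Nat.div_add_mod U d
          have h2 := Nat.mod_lt U hd0
          set f := U / d
          set g := U % d
          have h3 : (U : ℤ) * (moebius d * e) - (d * e : ℕ) * (moebius d * f) =
              moebius d * (e * g) := by
            rw [← h1]
            push_cast
            ring
          rw [h3]
          have h4 : moebius d ≤ 1 := (abs_le.1 abs_moebius_le_one).2
          have h5 : (0 : ℤ) ≤ e * g := by positivity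
          have h6 : e * g ≤ d * e := by nlinarith
          have h6' : (e : ℤ) * g ≤ (d * e : ℕ) := by exact_mod_cast h6
          nlinarith
      _ = _ := by
          simp only [sum_const, nsmul_eq_mul, T]
          ring
  have hqT := le_card_divisors_mul_totient hq
  have hq0 : (0 : ℤ) < q := by exact_mod_cast Nat.pos_of_ne_zero hq
  have h7 : (U : ℤ) * q ≤ U * (T * q.totient) := by
    have : (q : ℤ) ≤ T * q.totient := by exact_mod_cast hqT
    gcongr
  have h8 : (T : ℤ) * (U * q.totient - q * W) ≤ T * (q * T) := by gcongr
  have h9 : (U : ℤ) ≤ T * W + T ^ 2 := by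
    refine le_of_mul_le_mul_right ?_ hq0
    nlinarith
  exact_mod_cast h9

lemma card_sq_le_of_card_pow_four_le {g M T R : ℕ}
    (h : g ^ 4 ≤ 2 * M * (2 * T * g ^ 2 + R)) :
    (g : ℝ) ^ 2 ≤ 4 * M * T + √(2 * M) * √R := by
  rw [← Real.sqrt_mul (by positivity)]
  have h' : (g : ℝ) ^ 4 ≤ 2 * M * (2 * T * g ^ 2 + R) := by exact_mod_cast h
  set r := √(2 * (M : ℝ) * R) with hr
  have hr0 : 0 ≤ r := Real.sqrt_nonneg _
  have hr2 : r ^ 2 = 2 * M * R := Real.sq_sqrt (by positivity)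
  have hc : (0 : ℝ) ≤ 4 * M * T := by positivity
  by_contra! hlt
  nlinarith [mul_pos (lt_of_le_of_lt (by positivity) hlt) (sub_pos.2 hlt),
    mul_nonneg hr0 (sub_pos.2 hlt).le]

/-- The shift `n ↦ n + u v`, followed by Hölder's inequality and the fourth moment bound. -/
lemma card_mul_sq_le {q N M U V D : ℕ} (hq : Squarefree q) (hV : V < q) (hUV : U * V ≤ N)
    (hNU : 2 * N * U ≤ q) (hD : ∀ k, 0 < k → k ≤ q → #k.divisors ≤ D) (a : (ZMod q)ˣ)
    (X : Finset ℕ) (hX : X ⊆ Icc 1 N)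
    (hXM : ∀ n ∈ X, ∃ m ∈ Icc 1 M, (m : ZMod q) * (n : ZMod q) ^ 2 = a)
    (W : ℕ) (hW : W = #{u ∈ Icc 1 U | u.Coprime q}) :
    ((#X * W * V : ℕ) : ℝ) ^ 2 ≤ (2 * N * W) * ((2 * N * W) * (4 * M * D) +
      √(2 * M) * √(D * (2 * N * U) * (4 * V ^ 4 * D ^ 5))) := by
  have : NeZero q := ⟨hq.ne_zero⟩
  have hTD : #q.divisors ≤ D := hD q (Nat.pos_of_ne_zero hq.ne_zero) le_rfl
  set Us := {u ∈ Icc 1 U | u.Coprime q} with hUs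
  set P := Icc 1 (2 * N) ×ˢ Us with hP
  have hPcard : #P = 2 * N * W := by simp [hP, hW]
  set σ : ℕ × ℕ → ZMod q := fun x => (x.1 : ZMod q) * (x.2 : ZMod q)⁻¹ with hσ
  obtain ⟨I, hI⟩ : ∃ I : ℕ × ℕ → Finset ℕ, ∀ x v, v ∈ I x ↔ v ∈ Icc 1 V ∧
      ∃ m ∈ Icc 1 M, (m : ZMod q) * ((x.1 : ZMod q) - x.2 * v) ^ 2 = a :=
    ⟨fun x => (((Icc 1 V).finite_toSet).inter_of_left
      {v | ∃ m ∈ Icc 1 M, (m : ZMod q) * ((x.1 : ZMod q) - x.2 * v) ^ 2 = a}).toFinset,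
      fun x v => Set.Finite.mem_toFinset _⟩
  have hsum : #X * W * V ≤ ∑ x ∈ P, #(I x) := by
    rw [← card_sigma]
    have : #X * W * V = #((X ×ˢ Us) ×ˢ Icc 1 V) := by simp [hW]
    rw [this]
    refine card_le_card_of_injOn (fun y => ⟨(y.1.1 + y.1.2 * y.2, y.1.2), y.2⟩) ?_ ?_
    · intro y hy
      simp only [coe_product, Set.mem_prod, mem_coe] at hy
      obtain ⟨⟨hn, hu⟩, hv⟩ := hy
      have hn' := mem_Icc.1 (hX hn)
      have hu' := mem_Icc.1 (mem_filter.1 hu).1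
      have hv' := mem_Icc.1 hv
      have huv : y.1.2 * y.2 ≤ N := (Nat.mul_le_mul hu'.2 hv'.2).trans hUV
      simp only [hP, hI, coe_sigma, Set.mem_sigma_iff, mem_coe, mem_product, mem_Icc]
      refine ⟨⟨⟨by omega, by omega⟩, hu⟩, hv', ?_⟩
      obtain ⟨m, hm, h⟩ := hXM _ hn
      refine ⟨m, mem_Icc.1 hm, ?_⟩
      rw [← h]
      push_cast
      ring
    · rintro ⟨⟨n, u⟩, v⟩ - ⟨⟨n', u'⟩, v'⟩ - h
      simp only [Sigma.mk.injEq, Prod.mk.injEq, heq_eq_eq] at h ⊢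
      obtain ⟨⟨h1, rfl⟩, rfl⟩ := h
      exact ⟨⟨Nat.add_right_cancel h1, rfl⟩, rfl⟩
  have hbound : ∀ x ∈ P, (#(I x) : ℝ) ^ 2 ≤ 4 * M * D + √(2 * M) * √(relCount q V (σ x)) := by
    intro x hx
    have hu : x.2.Coprime q := (mem_filter.1 (mem_product.1 hx).2).2
    set w := ZMod.unitOfCoprime x.2 hu with hw
    refine card_sq_le_of_card_pow_four_le ((card_pow_four_le hq hV (σ x) (a * w⁻¹ ^ 2) (I x)
      (fun v hv => ((hI x v).1 hv).1) ?_).trans (by gcongr))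
    intro v hv
    obtain ⟨m, hm, h⟩ := ((hI x v).1 hv).2
    refine ⟨m, hm, ?_⟩
    have e1 := ZMod.coe_mul_inv_eq_one _ hu
    have e2 : ((w⁻¹ : (ZMod q)ˣ) : ZMod q) = (x.2 : ZMod q)⁻¹ := by
      rw [← ZMod.inv_coe_unit, hw, ZMod.coe_unitOfCoprime]
    rw [Units.val_mul, Units.val_pow_eq_pow_val, e2, ← h, hσ]
    have e3 : (x.1 : ZMod q) * (x.2 : ZMod q)⁻¹ - v = (x.1 - x.2 * v) * (x.2 : ZMod q)⁻¹ := by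
      linear_combination (v : ZMod q) * e1
    simp only [e3]
    ring
  have hrel : ∑ x ∈ P, √(relCount q V (σ x) : ℝ) ≤
      √(D * (2 * N * U) * (4 * V ^ 4 * D ^ 5)) := by
    refine (sum_sqrt_comp_le P σ (relCount q V)).trans (Real.sqrt_le_sqrt ?_)
    have h1 := card_ratio_eq_le hNU hD
    have h2 := (sum_relCount_le hq V).trans (Nat.mul_le_mul_left _ (Nat.pow_le_pow_left hTD 5))
    exact_mod_cast Nat.mul_le_mul h1 h2
  calc ((#X * W * V : ℕ) : ℝ) ^ 2 ≤ (∑ x ∈ P, (#(I x) : ℝ)) ^ 2 := by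
        gcongr
        exact_mod_cast hsum
    _ ≤ #P * ∑ x ∈ P, (#(I x) : ℝ) ^ 2 := sq_sum_le_card_mul_sum_sq
    _ ≤ #P * ∑ x ∈ P, (4 * M * D + √(2 * M) * √(relCount q V (σ x))) := by
        gcongr with x hx
        exact hbound x hx
    _ = (2 * N * W) * ((2 * N * W) * (4 * M * D) +
          √(2 * M) * ∑ x ∈ P, √(relCount q V (σ x) : ℝ)) := by
        rw [sum_add_distrib, sum_const, nsmul_eq_mul, mul_sum, hPcard]
        push_cast
        rfl
    _ ≤ _ := by gcongr

lemma exists_card_divisors_le_rpow {ε : ℝ} (hε : 0 < ε) :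
    ∃ C : ℝ, 0 < C ∧ ∀ n : ℕ, n ≠ 0 → (#n.divisors : ℝ) ≤ C * (n : ℝ) ^ ε := by
  set δ : ℝ := 2 ^ ε - 1 with hδ
  have hδ0 : 0 < δ := sub_pos.2 (Real.one_lt_rpow one_lt_two hε)
  set c : ℝ := 1 + 1 / δ with hc
  have hc1 : 1 ≤ c := by
    have : 0 < 1 / δ := by positivity
    linarith
  set B := ⌈(2 : ℝ) ^ (1 / ε)⌉₊ with hB
  refine ⟨c ^ B, by positivity, fun n hn => ?_⟩
  have hlocal : ∀ p ∈ n.primeFactors, ((n.factorization p + 1 : ℕ) : ℝ) ≤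
      (if p < B then c else 1) * ((p : ℝ) ^ n.factorization p) ^ ε := by
    intro p hp
    have hp2 : (2 : ℝ) ≤ p := by exact_mod_cast (Nat.prime_of_mem_primeFactors hp).two_le
    rw [← Real.rpow_natCast, ← Real.rpow_mul (by positivity), mul_comm (_ : ℝ) ε,
      Real.rpow_mul (by positivity), Real.rpow_natCast]
    set e := n.factorization p
    push_cast
    split_ifs with hpB
    · have h1 : 1 + δ ≤ (p : ℝ) ^ ε := by
        rw [hδ, add_sub_cancel]
        exact Real.rpow_le_rpow zero_le_two hp2 hε.le
      have h2 : 1 + e * δ ≤ (1 + δ) ^ e := one_add_mul_le_pow (by linarith) e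
      calc (e : ℝ) + 1 ≤ c * (1 + e * δ) := by
            have : c * (1 + e * δ) = 1 + e + (e * δ + 1 / δ) := by
              rw [hc]
              field_simp
              ring
            rw [this]
            have : 0 ≤ e * δ + 1 / δ := by positivity
            linarith
        _ ≤ c * ((p : ℝ) ^ ε) ^ e := by
            gcongr
            exact h2.trans (by gcongr)
    · have h1 : (2 : ℝ) ≤ (p : ℝ) ^ ε := by
        have h3 : (2 : ℝ) ^ (1 / ε) ≤ p :=
          (Nat.le_ceil _).trans (by exact_mod_cast not_lt.1 hpB)
        calc (2 : ℝ) = ((2 : ℝ) ^ (1 / ε)) ^ ε := by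
              rw [← Real.rpow_mul zero_le_two, one_div_mul_cancel hε.ne', Real.rpow_one]
          _ ≤ _ := Real.rpow_le_rpow (by positivity) h3 hε.le
      have h2 : (e : ℝ) + 1 ≤ 2 ^ e := by exact_mod_cast Nat.lt_two_pow_self (n := e)
      rw [one_mul]
      exact h2.trans (by gcongr)
  rw [Nat.card_divisors hn]
  push_cast
  calc ∏ p ∈ n.primeFactors, ((n.factorization p : ℝ) + 1)
      ≤ ∏ p ∈ n.primeFactors, (if p < B then c else 1) * ((p : ℝ) ^ n.factorization p) ^ ε := by
        refine prod_le_prod (fun p _ => by positivity) fun p hp => ?_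
        exact_mod_cast hlocal p hp
    _ = c ^ #{p ∈ n.primeFactors | p < B} * (n : ℝ) ^ ε := by
        rw [prod_mul_distrib, prod_ite, prod_const_one, mul_one, prod_const,
          Real.finsetProd_rpow _ _ fun p _ => by positivity]
        congr 2
        conv_rhs => rw [← Nat.prod_factorization_pow_eq_self hn]
        rw [Nat.prod_factorization_eq_prod_primeFactors]
        push_cast
        rfl
    _ ≤ _ := by
        gcongr
        refine (card_le_card fun p hp => ?_).trans (card_range B).le
        exact mem_range.2 (mem_filter.1 hp).2

lemma le_of_moment_bound {S W V N M U D x y : ℝ} (hW : 0 < W) (hV : 0 ≤ V)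
    (hN : 0 ≤ N) (hM : 0 ≤ M) (hU : 0 ≤ U) (hD : 1 ≤ D) (hx : 0 < x) (hy : 0 ≤ y) (hyx : y ≤ x)
    (hNx : N ≤ x ^ 3) (hMy : M ≤ y ^ 4) (hUx : U ≤ x) (hVx : x ^ 2 / 2 ≤ V) (hWx : x ≤ 8 * D * W)
    (h : (S * W * V) ^ 2 ≤ (2 * N * W) * ((2 * N * W) * (4 * M * D) +
      √(2 * M) * √(D * (2 * N * U) * (4 * V ^ 4 * D ^ 5)))) :
    S ≤ 12 * D ^ 2 * (x ^ 2 * y) := by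
  have hD0 : 0 ≤ D := by linarith
  have hroot : √(2 * M) * √(D * (2 * N * U) * (4 * V ^ 4 * D ^ 5)) ≤
      4 * D ^ 3 * V ^ 2 * (y ^ 2 * x ^ 2) := by
    rw [← Real.sqrt_mul (by positivity)]
    refine Real.sqrt_le_iff.2 ⟨by positivity, ?_⟩
    calc 2 * M * (D * (2 * N * U) * (4 * V ^ 4 * D ^ 5))
        ≤ 2 * y ^ 4 * (D * (2 * x ^ 3 * x) * (4 * V ^ 4 * D ^ 5)) := by gcongr
      _ = _ := by ring
  have h1 : S ^ 2 * (W * V ^ 2) ≤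
      16 * x ^ 6 * y ^ 4 * D * W + 8 * x ^ 5 * y ^ 2 * D ^ 3 * V ^ 2 := by
    refine le_of_mul_le_mul_right ?_ hW
    calc S ^ 2 * (W * V ^ 2) * W = (S * W * V) ^ 2 := by ring
      _ ≤ (2 * x ^ 3 * W) * ((2 * x ^ 3 * W) * (4 * y ^ 4 * D) +
          4 * D ^ 3 * V ^ 2 * (y ^ 2 * x ^ 2)) := h.trans (by gcongr)
      _ = _ := by ring
  have hV0 : 0 < V := lt_of_lt_of_le (by positivity) hVx
  have hVsq : x ^ 4 ≤ 4 * V ^ 2 := by nlinarith [sq_nonneg x]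
  have h2 : 16 * x ^ 6 * y ^ 4 * D * W ≤ 64 * x ^ 4 * y ^ 2 * D ^ 4 * (W * V ^ 2) :=
    calc 16 * x ^ 6 * y ^ 4 * D * W = 16 * x ^ 6 * y ^ 2 * W * (y ^ 2 * D ^ 1) := by ring
      _ ≤ 16 * x ^ 6 * y ^ 2 * W * (x ^ 2 * D ^ 4) := by
        gcongr
        norm_num
      _ = 16 * x ^ 4 * y ^ 2 * D ^ 4 * W * x ^ 4 := by ring
      _ ≤ 16 * x ^ 4 * y ^ 2 * D ^ 4 * W * (4 * V ^ 2) := by gcongr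
      _ = _ := by ring
  have h3 : 8 * x ^ 5 * y ^ 2 * D ^ 3 * V ^ 2 ≤ 64 * x ^ 4 * y ^ 2 * D ^ 4 * (W * V ^ 2) :=
    calc 8 * x ^ 5 * y ^ 2 * D ^ 3 * V ^ 2 = 8 * x ^ 4 * y ^ 2 * D ^ 3 * V ^ 2 * x := by ring
      _ ≤ 8 * x ^ 4 * y ^ 2 * D ^ 3 * V ^ 2 * (8 * D * W) := by gcongr
      _ = _ := by ring
  have h4 : S ^ 2 ≤ 128 * x ^ 4 * y ^ 2 * D ^ 4 :=
    le_of_mul_le_mul_right (by linarith) (mul_pos hW (pow_pos hV0 2))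
  refine abs_le_of_sq_le_sq' ?_ (by positivity) |>.2
  have : 0 ≤ x ^ 4 * y ^ 2 * D ^ 4 := by positivity
  nlinarith

lemma card_le_of_divisor_bound {q D : ℕ} (hq : Squarefree q)
    (hD : ∀ k, 0 < k → k ≤ q → #k.divisors ≤ D) (a : (ZMod q)ˣ) {N M : ℕ} {x y : ℝ} (hx : 1 ≤ x)
    (hy : 1 ≤ y) (hxq : x ^ 4 ≤ q) (hNx : (N : ℝ) ≤ x ^ 3) (hxN : x ^ 3 < N + 1)
    (hMy : (M : ℝ) ≤ y ^ 4)
    (X : Finset ℕ) (hX : X ⊆ Icc 1 N)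
    (hXM : ∀ n ∈ X, ∃ m ∈ Icc 1 M, (m : ZMod q) * (n : ZMod q) ^ 2 = a) :
    (#X : ℝ) ≤ 12 * D ^ 2 * (x ^ 2 * y) := by
  have hq0 : 0 < q := Nat.pos_of_ne_zero hq.ne_zero
  have hD1 : 1 ≤ D := by simpa using hD 1 one_pos hq0
  have hD1' : (1 : ℝ) ≤ D := by exact_mod_cast hD1
  have htriv : (#X : ℝ) ≤ x ^ 3 := by
    refine le_trans ?_ hNx
    exact_mod_cast (card_le_card hX).trans (by simp)
  rcases lt_or_ge x y with hxy | hyx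
  · calc (#X : ℝ) ≤ 1 * 1 ^ 2 * (x ^ 2 * x) := by linarith
      _ ≤ 12 * D ^ 2 * (x ^ 2 * y) := by gcongr; norm_num
  set K := ⌊x⌋₊ with hK
  have hKx : (K : ℝ) ≤ x := Nat.floor_le (by linarith)
  have hxK : x < K + 1 := Nat.lt_floor_add_one x
  have hK2 : 2 * (K / 2) ≤ K ∧ K ≤ 2 * (K / 2) + 1 := by omega
  set U := K / 2 with hU
  have hUK : 2 * (U : ℝ) ≤ K := by exact_mod_cast hK2.1
  have hKU : (K : ℝ) ≤ 2 * U + 1 := by exact_mod_cast hK2.2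
  rcases lt_or_ge U (2 * D ^ 2) with hsmall | hlarge
  · have h1 : (U : ℝ) ≤ 2 * D ^ 2 := by exact_mod_cast hsmall.le
    have hx12 : x ≤ 12 * D ^ 2 := by nlinarith
    calc (#X : ℝ) ≤ x * (x ^ 2 * 1) := by linarith
      _ ≤ 12 * D ^ 2 * (x ^ 2 * y) := by gcongr
  have hU2 : 2 ≤ U := le_trans (by nlinarith) hlarge
  have hU2' : (2 : ℝ) ≤ U := by exact_mod_cast hU2
  have hx4 : 4 ≤ x := by linarith
  set W := #{u ∈ Icc 1 U | u.Coprime q} with hW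
  have hTD : #q.divisors ≤ D := hD q hq0 le_rfl
  have hWU : U ≤ 2 * (D * W) := by
    have : U ≤ #q.divisors * W + #q.divisors ^ 2 := le_card_coprime hq.ne_zero U
    have h1 : #q.divisors * W ≤ D * W := by gcongr
    have h2 : #q.divisors ^ 2 ≤ D ^ 2 := by gcongr
    omega
  have hWU' : (U : ℝ) ≤ 2 * (D * W) := by exact_mod_cast hWU
  have hW0 : 0 < W := Nat.pos_of_ne_zero fun h => by simp [h] at hWU; omega
  have hUV : U * K ^ 2 ≤ N := by
    have h1 : ((U * K ^ 2 : ℕ) : ℝ) < (N + 1 : ℕ) := by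
      push_cast
      calc (U : ℝ) * K ^ 2 ≤ x * x ^ 2 := by gcongr; linarith
        _ = x ^ 3 := by ring
        _ < _ := hxN
    exact Nat.lt_succ_iff.1 (by exact_mod_cast h1)
  have hNU : 2 * N * U ≤ q := by
    have h1 : ((2 * N * U : ℕ) : ℝ) ≤ q := by
      push_cast
      calc 2 * (N : ℝ) * U = N * (2 * U) := by ring
        _ ≤ x ^ 3 * x := by gcongr; linarith
        _ = x ^ 4 := by ring
        _ ≤ q := hxq
    exact_mod_cast h1
  have hV : K ^ 2 < q := by
    have h1 : ((K ^ 2 : ℕ) : ℝ) < q := by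
      push_cast
      calc (K : ℝ) ^ 2 ≤ x ^ 2 := by gcongr
        _ < x ^ 4 := pow_lt_pow_right₀ (by linarith) (by norm_num)
        _ ≤ q := hxq
    exact_mod_cast h1
  have hmain := card_mul_sq_le hq hV hUV hNU hD a X hX hXM W rfl
  push_cast at hmain
  refine le_of_moment_bound (Nat.cast_pos.2 hW0) (by positivity)
    (Nat.cast_nonneg N) (Nat.cast_nonneg M) (Nat.cast_nonneg U) hD1' (by linarith) (by linarith)
    hyx hNx hMy (by linarith) ?_ ?_ hmain
  · nlinarith
  · linarith

/-- Pierce's bound for S_{2,-1}(N,M,q,a), via the symmetry S_{1,-2}(M,N,q,a) =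
S_{2,-1}(N,M,q,a): for every ε > 0 there is C = C(ε) such that for q squarefree, a a
unit mod q, 1 ≤ N ≤ q^(3/4) and 1 ≤ M < q/2, the number of pairs (m,n) of positive
integers with m ≤ M, n ≤ N, gcd(m,q) = 1 and m·n² ≡ a (mod q) is at most
C · M^(1/4) · N^(2/3) · q^ε. -/
theorem pierce_bound_S_two_negone :
    ∀ ε : ℝ, 0 < ε → ∃ C : ℝ, 0 < C ∧
      ∀ q : ℕ, Squarefree q → ∀ a : (ZMod q)ˣ, ∀ M N : ℝ,
        1 ≤ N → N ≤ (q : ℝ) ^ ((3 : ℝ) / 4) → 1 ≤ M → M < (q : ℝ) / 2 →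
          ((((Finset.Icc 1 ⌊M⌋₊) ×ˢ (Finset.Icc 1 ⌊N⌋₊)).filter
              (fun p : ℕ × ℕ => Nat.gcd p.1 q = 1 ∧
                (p.1 : ZMod q) * (p.2 : ZMod q) ^ 2 = (a : ZMod q))).card : ℝ)
            ≤ C * M ^ ((1 : ℝ) / 4) * N ^ ((2 : ℝ) / 3) * (q : ℝ) ^ ε := by
  intro ε hε
  obtain ⟨C, hC, hdiv⟩ := exists_card_divisors_le_rpow (half_pos hε)
  refine ⟨12 * C ^ 2, by positivity, fun q hq a M N hN hNq hM hMq => ?_⟩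
  have hMq' : ⌊M⌋₊ < q := by
    have h1 : (⌊M⌋₊ : ℝ) ≤ M := Nat.floor_le (by linarith)
    have h2 : (⌊M⌋₊ : ℝ) < q := by linarith [(Nat.cast_nonneg q : (0 : ℝ) ≤ q)]
    exact_mod_cast h2
  set Z := ((Finset.Icc 1 ⌊M⌋₊) ×ˢ (Finset.Icc 1 ⌊N⌋₊)).filter
    (fun p : ℕ × ℕ => Nat.gcd p.1 q = 1 ∧
      (p.1 : ZMod q) * (p.2 : ZMod q) ^ 2 = (a : ZMod q)) with hZ
  have hcard : #(Z.image Prod.snd) = #Z := by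
    refine card_image_of_injOn ?_
    rintro ⟨m, n⟩ h ⟨m', n'⟩ h' rfl
    simp only [hZ, coe_filter, Set.mem_ofPred_eq, mem_product, mem_Icc] at h h'
    have hu : IsUnit ((n : ZMod q) ^ 2) := isUnit_of_mul_isUnit_right (h.2.2 ▸ a.isUnit)
    have hmm : (m : ZMod q) = m' := hu.mul_right_cancel (h.2.2.trans h'.2.2.symm)
    exact Prod.ext (natCast_inj_of_lt (h.1.1.2.trans_lt hMq') (h'.1.1.2.trans_lt hMq') hmm) rfl
  set D := ⌊C * (q : ℝ) ^ (ε / 2)⌋₊ with hD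
  have hq0 : (0 : ℝ) < q := Nat.cast_pos.2 (Nat.pos_of_ne_zero hq.ne_zero)
  have hDk : ∀ k, 0 < k → k ≤ q → #k.divisors ≤ D := fun k hk hkq => Nat.le_floor <|
    (hdiv k hk.ne').trans (by gcongr)
  have hN0 : 0 ≤ N := by linarith
  have hM0 : 0 ≤ M := by linarith
  have hx3 : (N ^ ((1 : ℝ) / 3)) ^ 3 = N := by
    rw [← Real.rpow_natCast, ← Real.rpow_mul hN0]
    norm_num
  have hy4 : (M ^ ((1 : ℝ) / 4)) ^ 4 = M := by
    rw [← Real.rpow_natCast, ← Real.rpow_mul hM0]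
    norm_num
  have hx2 : (N ^ ((1 : ℝ) / 3)) ^ 2 = N ^ ((2 : ℝ) / 3) := by
    rw [← Real.rpow_natCast, ← Real.rpow_mul hN0]
    norm_num
  have hx4 : (N ^ ((1 : ℝ) / 3)) ^ 4 ≤ q := by
    calc (N ^ ((1 : ℝ) / 3)) ^ 4 = N ^ ((4 : ℝ) / 3) := by
          rw [← Real.rpow_natCast, ← Real.rpow_mul hN0]
          norm_num
      _ ≤ ((q : ℝ) ^ ((3 : ℝ) / 4)) ^ ((4 : ℝ) / 3) := by gcongr
      _ = q := by
          rw [← Real.rpow_mul hq0.le]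
          norm_num
  have hDq : (D : ℝ) ^ 2 ≤ C ^ 2 * (q : ℝ) ^ ε := by
    calc (D : ℝ) ^ 2 ≤ (C * (q : ℝ) ^ (ε / 2)) ^ 2 := by
          gcongr
          exact Nat.floor_le (by positivity)
      _ = C ^ 2 * (q : ℝ) ^ ε := by
          rw [mul_pow, ← Real.rpow_natCast ((q : ℝ) ^ (ε / 2)), ← Real.rpow_mul hq0.le]
          norm_num
  have hmain := card_le_of_divisor_bound hq hDk a (N := ⌊N⌋₊) (M := ⌊M⌋₊)
    (Real.one_le_rpow hN (by norm_num : (0 : ℝ) ≤ 1 / 3))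
    (Real.one_le_rpow hM (by norm_num : (0 : ℝ) ≤ 1 / 4)) hx4
    (by rw [hx3]; exact Nat.floor_le hN0) (by rw [hx3]; exact Nat.lt_floor_add_one N)
    (by rw [hy4]; exact Nat.floor_le hM0) (Z.image Prod.snd) ?_ ?_
  · rw [hcard, hx2] at hmain
    calc (#Z : ℝ) ≤ 12 * D ^ 2 * (N ^ ((2 : ℝ) / 3) * M ^ ((1 : ℝ) / 4)) := hmain
      _ ≤ 12 * (C ^ 2 * (q : ℝ) ^ ε) * (N ^ ((2 : ℝ) / 3) * M ^ ((1 : ℝ) / 4)) := by gcongr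
      _ = _ := by ring
  · intro n hn
    obtain ⟨p, hp, rfl⟩ := mem_image.1 hn
    exact (mem_product.1 (mem_filter.1 hp).1).2
  · intro n hn
    obtain ⟨p, hp, rfl⟩ := mem_image.1 hn
    rw [hZ, mem_filter, mem_product] at hp
    exact ⟨p.1, hp.1.1, hp.2.2⟩
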